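/- Let n, d be positive integers and let μ be the Haar probability measure on the compact group unitaryGroup (Fin d) ℂ. For every complex matrix X indexed by (Fin n → Fin d), the Haar twirl T(X) := ∫ U^{⊗n} · X · (U^{⊗n})ᴴ dμ(U) lies in the ℂ-linear span of the permutation matrices {P_σ : σ ∈ Equiv.Perm (Fin n)}. (This is the averaging over random unitaries on the purifying system that produces the random purification/dilation in Theorems 1 and 2.) -/

import Mathlib

open Matrix MeasureTheory

/-- The `n`-th Kronecker power of a `d × d` complex matrix, acting on `(ℂ^d)^{⊗n}`,
indexed by `Fin n → Fin d`. -/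
noncomputable def kroneckerPower {d : ℕ} (n : ℕ) (A : Matrix (Fin d) (Fin d) ℂ) :
    Matrix (Fin n → Fin d) (Fin n → Fin d) ℂ :=
  fun f g => ∏ k : Fin n, A (f k) (g k)

/-- The permutation matrix on `(ℂ^d)^{⊗n}` permuting tensor factors according to `σ`. -/
noncomputable def permMatrix (n d : ℕ) (σ : Equiv.Perm (Fin n)) :
    Matrix (Fin n → Fin d) (Fin n → Fin d) ℂ :=
  fun f g => if f = g ∘ ⇑σ⁻¹ then 1 else 0

theorem kp_mul {d : ℕ} (n : ℕ) (A B : Matrix (Fin d) (Fin d) ℂ) :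
    kroneckerPower n (A * B) = kroneckerPower n A * kroneckerPower n B := by
  ext f g
  simp only [kroneckerPower, Matrix.mul_apply, Finset.prod_univ_sum, Fintype.piFinset_univ,
    Finset.prod_mul_distrib]

theorem kp_one {d : ℕ} (n : ℕ) :
    kroneckerPower n (1 : Matrix (Fin d) (Fin d) ℂ) = 1 := by
  ext f g
  simp only [kroneckerPower, Matrix.one_apply]
  by_cases h : f = g
  · simp [h]
  · rw [if_neg h]
    obtain ⟨k, hk⟩ := Function.ne_iff.mp h
    exact Finset.prod_eq_zero (Finset.mem_univ k) (if_neg hk)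

theorem kp_conjTranspose {d : ℕ} (n : ℕ) (A : Matrix (Fin d) (Fin d) ℂ) :
    kroneckerPower n Aᴴ = (kroneckerPower n A)ᴴ := by
  ext f g
  simp [kroneckerPower, Matrix.conjTranspose_apply]

theorem kp_diagonal {d : ℕ} (n : ℕ) (z : Fin d → ℂ) :
    kroneckerPower n (Matrix.diagonal z) = Matrix.diagonal (fun f => ∏ k, z (f k)) := by
  ext f g
  simp only [kroneckerPower, Matrix.diagonal_apply]
  by_cases h : f = g
  · simp [h]
  · rw [if_neg h]
    obtain ⟨k, hk⟩ := Function.ne_iff.mp h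
    exact Finset.prod_eq_zero (Finset.mem_univ k) (if_neg hk)

theorem compact_unitary (d : ℕ) : CompactSpace (Matrix.unitaryGroup (Fin d) ℂ) := by
  have hK : IsCompact (Set.pi Set.univ (fun _ : Fin d => Set.pi Set.univ
      (fun _ : Fin d => Metric.closedBall (0 : ℂ) 1))) :=
    isCompact_univ_pi fun _ => isCompact_univ_pi fun _ => isCompact_closedBall _ _
  have hc : IsClosed {A : Matrix (Fin d) (Fin d) ℂ | A * star A = 1} :=
    isClosed_eq (by fun_prop) continuous_const
  have he : {A : Matrix (Fin d) (Fin d) ℂ | A * star A = 1} =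
      (Matrix.unitaryGroup (Fin d) ℂ : Set (Matrix (Fin d) (Fin d) ℂ)) := by
    ext A
    simp [Matrix.mem_unitaryGroup_iff]
  rw [he] at hc
  have : IsCompact (Matrix.unitaryGroup (Fin d) ℂ : Set (Matrix (Fin d) (Fin d) ℂ)) := by
    refine IsCompact.of_isClosed_subset hK hc ?_
    intro A hA
    intro i _ j _
    exact mem_closedBall_zero_iff.mpr <| entry_norm_bound_of_unitary hA i j
  exact isCompact_iff_compactSpace.mp this

/-- The twirl commutes with unitary Kronecker powers. -/
theorem twirl_comm (n d : ℕ)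
    [MeasurableSpace (Matrix.unitaryGroup (Fin d) ℂ)]
    [BorelSpace (Matrix.unitaryGroup (Fin d) ℂ)]
    (μ : Measure (Matrix.unitaryGroup (Fin d) ℂ))
    [μ.IsHaarMeasure] [IsProbabilityMeasure μ]
    (X Y : Matrix (Fin n → Fin d) (Fin n → Fin d) ℂ)
    (hY : Y = (fun f g => ∫ U : Matrix.unitaryGroup (Fin d) ℂ,
        (kroneckerPower n (U : Matrix (Fin d) (Fin d) ℂ) * X *
          (kroneckerPower n (U : Matrix (Fin d) (Fin d) ℂ))ᴴ) f g ∂μ))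
    (V : Matrix.unitaryGroup (Fin d) ℂ) :
    kroneckerPower n (V : Matrix (Fin d) (Fin d) ℂ) * Y = Y * kroneckerPower n V := by
  have := compact_unitary d
  set F : Matrix.unitaryGroup (Fin d) ℂ → Matrix (Fin n → Fin d) (Fin n → Fin d) ℂ :=
    fun U => kroneckerPower n (U : Matrix (Fin d) (Fin d) ℂ) * X *
          (kroneckerPower n (U : Matrix (Fin d) (Fin d) ℂ))ᴴ with hF
  have hKc : Continuous fun U : Matrix.unitaryGroup (Fin d) ℂ =>
      kroneckerPower n (U : Matrix (Fin d) (Fin d) ℂ) := by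
    refine continuous_matrix fun f g => ?_
    refine continuous_finsetProd _ fun k _ => ?_
    exact continuous_subtype_val.matrix_elem _ _
  have hFc : Continuous F := (hKc.matrix_mul continuous_const).matrix_mul hKc.matrix_conjTranspose
  have hFi : ∀ f g, Integrable (fun U => F U f g) μ := fun f g =>
    (hFc.matrix_elem f g).integrable_of_hasCompactSupport (HasCompactSupport.of_compactSpace _)
  have hY' : ∀ f g, Y f g = ∫ U, F U f g ∂μ := fun f g => by rw [hY]
  have hconj : kroneckerPower n (V : Matrix (Fin d) (Fin d) ℂ) * Y *
      (kroneckerPower n (V : Matrix (Fin d) (Fin d) ℂ))ᴴ = Y := by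
    have hFV : ∀ U, F (V * U) = kroneckerPower n (V : Matrix (Fin d) (Fin d) ℂ) * F U *
      (kroneckerPower n (V : Matrix (Fin d) (Fin d) ℂ))ᴴ := by
      intro U
      simp only [hF, Submonoid.coe_mul, kp_mul, Matrix.conjTranspose_mul, Matrix.mul_assoc]
    ext f g
    rw [hY' f g, ← integral_mul_left_eq_self _ V]
    simp only [hFV]
    simp only [Matrix.mul_apply, hY', Finset.sum_mul]
    rw [integral_finsetSum _ fun a _ => ?_]
    · refine Finset.sum_congr rfl fun a _ => ?_
      rw [integral_finsetSum _ fun b _ => ?_]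
      · refine Finset.sum_congr rfl fun b _ => ?_
        rw [integral_mul_const, integral_const_mul]
      · exact ((hFi _ _).const_mul _).mul_const _
    · exact integrable_finsetSum _ fun b _ => ((hFi _ _).const_mul _).mul_const _
  have hu : (kroneckerPower n (V : Matrix (Fin d) (Fin d) ℂ))ᴴ *
      kroneckerPower n (V : Matrix (Fin d) (Fin d) ℂ) = 1 := by
    rw [← kp_conjTranspose, ← kp_mul, ← kp_one]
    congr 1
    exact Matrix.mem_unitaryGroup_iff'.mp V.2
  conv_rhs => rw [← hconj]
  rw [Matrix.mul_assoc _ _ (kroneckerPower n _), hu, Matrix.mul_one]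

theorem comm_diag {n d : ℕ} (Y : Matrix (Fin n → Fin d) (Fin n → Fin d) ℂ)
    (h : ∀ V : Matrix.unitaryGroup (Fin d) ℂ,
      kroneckerPower n (V : Matrix (Fin d) (Fin d) ℂ) * Y = Y * kroneckerPower n V)
    (z : Fin d → ℂ) :
    kroneckerPower n (Matrix.diagonal z) * Y = Y * kroneckerPower n (Matrix.diagonal z) := by
  ext f g
  rw [kp_diagonal, Matrix.diagonal_mul, Matrix.mul_diagonal]
  have hp : (∏ k, MvPolynomial.X (f k)) * MvPolynomial.C (Y f g) =
      MvPolynomial.C (Y f g) * ∏ k, (MvPolynomial.X (g k) : MvPolynomial (Fin d) ℂ) := by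
    refine MvPolynomial.funext_set (fun _ => Metric.sphere (0 : ℂ) 1) (fun _ => ?_) ?_
    · refine (isPreconnected_sphere (by simp [Complex.rank_real_complex]) (0 : ℂ)
        1).infinite_of_nontrivial ⟨1, by simp, -1, by simp, ?_⟩
      norm_num
    · intro w hw
      have hw' : ∀ i, ‖w i‖ = 1 := fun i => by simpa using hw i (Set.mem_univ i)
      have hU : Matrix.diagonal w ∈ Matrix.unitaryGroup (Fin d) ℂ := by
        rw [Matrix.mem_unitaryGroup_iff, Matrix.star_eq_conjTranspose,
          Matrix.diagonal_conjTranspose, Matrix.diagonal_mul_diagonal, ← Matrix.diagonal_one]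
        congr 1
        ext i
        simp [Complex.mul_conj, Complex.normSq_eq_norm_sq, hw']
      have := congrFun (congrFun (h ⟨_, hU⟩) f) g
      simp only [kp_diagonal, Matrix.diagonal_mul, Matrix.mul_diagonal] at this
      simpa using this
  simpa using congrArg (MvPolynomial.eval z) hp

theorem comm_herm {n d : ℕ} (Y : Matrix (Fin n → Fin d) (Fin n → Fin d) ℂ)
    (h : ∀ V : Matrix.unitaryGroup (Fin d) ℂ,
      kroneckerPower n (V : Matrix (Fin d) (Fin d) ℂ) * Y = Y * kroneckerPower n V)
    (H : Matrix (Fin d) (Fin d) ℂ) (hH : H.IsHermitian) :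
    kroneckerPower n H * Y = Y * kroneckerPower n H := by
  have hs := hH.spectral_theorem
  rw [Unitary.conjStarAlgAut_apply] at hs
  have h1 := h hH.eigenvectorUnitary
  have h2 := h (star hH.eigenvectorUnitary)
  rw [Unitary.coe_star] at h2
  have h3 := comm_diag Y h (RCLike.ofReal ∘ hH.eigenvalues)
  rw [hs, kp_mul, kp_mul]
  exact (Commute.mul_left (Commute.mul_left h1 h3) h2)

theorem comm_all {n d : ℕ} (Y : Matrix (Fin n → Fin d) (Fin n → Fin d) ℂ)
    (h : ∀ V : Matrix.unitaryGroup (Fin d) ℂ,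
      kroneckerPower n (V : Matrix (Fin d) (Fin d) ℂ) * Y = Y * kroneckerPower n V)
    (A : Matrix (Fin d) (Fin d) ℂ) :
    kroneckerPower n A * Y = Y * kroneckerPower n A := by
  obtain ⟨H, K, hH, hK, rfl⟩ : ∃ H K : Matrix (Fin d) (Fin d) ℂ, H.IsHermitian ∧ K.IsHermitian ∧
      A = H + Complex.I • K := by
    refine ⟨(realPart A : Matrix (Fin d) (Fin d) ℂ), (imaginaryPart A : Matrix (Fin d) (Fin d) ℂ),
      (realPart A).2, (imaginaryPart A).2, (realPart_add_I_smul_imaginaryPart A).symm⟩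
  ext f g
  have hp : ∑ a, (∏ k, (Polynomial.C (H (f k) (a k)) + Polynomial.C (K (f k) (a k)) * Polynomial.X))
        * Polynomial.C (Y a g) = ∑ a, Polynomial.C (Y f a) *
        (∏ k, (Polynomial.C (H (a k) (g k)) + Polynomial.C (K (a k) (g k)) * Polynomial.X)) := by
    refine Polynomial.eq_of_infinite_eval_eq _ _ (Set.Infinite.mono ?_
      (Set.infinite_range_of_injective Complex.ofReal_injective))
    rintro _ ⟨t, rfl⟩
    have hHK : (H + (t : ℂ) • K).IsHermitian := by
      refine hH.add ?_
      rw [Matrix.IsHermitian, Matrix.conjTranspose_smul, hK.eq]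
      simp
    have := congrFun (congrFun (comm_herm Y h _ hHK) f) g
    simp only [Matrix.mul_apply, kroneckerPower, Matrix.add_apply, Matrix.smul_apply,
      smul_eq_mul, mul_comm (t : ℂ)] at this
    simpa [Polynomial.eval_finsetSum, Polynomial.eval_prod] using this
  have := congrArg (Polynomial.eval Complex.I) hp
  simp only [Matrix.mul_apply, kroneckerPower, Matrix.add_apply, Matrix.smul_apply,
      smul_eq_mul, mul_comm Complex.I]
  simpa [Polynomial.eval_finsetSum, Polynomial.eval_prod] using this

/-- signed sum over sign vectors -/
theorem unit_sign_sum {n : ℕ} (c : Fin n → Fin n) :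
    ∑ e : Fin n → ℤˣ, (∏ k, ((e k : ℤ) : ℂ)) * ∏ k, ((e (c k) : ℤ) : ℂ) =
      if Function.Bijective c then (2 : ℂ) ^ n else 0 := by
  split_ifs with hc
  · have : ∀ e : Fin n → ℤˣ, (∏ k, ((e k : ℤ) : ℂ)) * ∏ k, ((e (c k) : ℤ) : ℂ) = 1 := by
      intro e
      rw [Function.Bijective.prod_comp hc (fun k => ((e k : ℤ) : ℂ)), ← Finset.prod_mul_distrib]
      refine Finset.prod_eq_one fun k _ => ?_
      rcases Int.units_eq_one_or (e k) with h | h <;> simp [h]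
    simp [this]
  · have hs : ¬ Function.Surjective c := fun h => hc (Finite.surjective_iff_bijective.mp h)
    simp only [Function.Surjective, not_forall, not_exists] at hs
    obtain ⟨j, hj⟩ := hs
    have := Fintype.sum_equiv (Equiv.mulLeft (Pi.mulSingle j (-1) : Fin n → ℤˣ))
      (fun e : Fin n → ℤˣ => -((∏ k, ((e k : ℤ) : ℂ)) * ∏ k, ((e (c k) : ℤ) : ℂ)))
      (fun e : Fin n → ℤˣ => (∏ k, ((e k : ℤ) : ℂ)) * ∏ k, ((e (c k) : ℤ) : ℂ)) ?_
    · rw [Finset.sum_neg_distrib] at this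
      exact self_eq_neg.mp this.symm
    · intro e
      have h1 : ∀ k, (Pi.mulSingle j (-1) : Fin n → ℤˣ) (c k) = 1 := fun k =>
        Pi.mulSingle_eq_of_ne (hj k) _
      have h2 : ∏ k, ((((Pi.mulSingle j (-1) : Fin n → ℤˣ) k : ℤˣ) : ℤ) : ℂ) = -1 := by
        rw [Finset.prod_eq_single j]
        · simp
        · intro b _ hb
          simp [Pi.mulSingle_eq_of_ne hb]
        · simp
      simp only [Equiv.coe_mulLeft, Pi.mul_apply, h1, one_mul, Units.val_mul, Int.cast_mul,
        Finset.prod_mul_distrib, h2]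
      ring

theorem polarize {n d : ℕ} (A : Fin n → Matrix (Fin d) (Fin d) ℂ) (f g : Fin n → Fin d) :
    (∑ e : Fin n → ℤˣ, (∏ k, ((e k : ℤ) : ℂ)) •
      kroneckerPower n (∑ j, ((e j : ℤ) : ℂ) • A j)) f g =
    (2 : ℂ) ^ n * ∑ σ : Equiv.Perm (Fin n), ∏ k, A (σ k) (f k) (g k) := by
  have h1 : ∀ e : Fin n → ℤˣ, kroneckerPower n (∑ j, ((e j : ℤ) : ℂ) • A j) f g =
      ∑ c : Fin n → Fin n, (∏ k, ((e (c k) : ℤ) : ℂ)) * ∏ k, A (c k) (f k) (g k) := by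
    intro e
    simp only [kroneckerPower, Matrix.sum_apply, Matrix.smul_apply, smul_eq_mul,
      Finset.prod_univ_sum, Fintype.piFinset_univ, Finset.prod_mul_distrib]
  simp only [Matrix.sum_apply, Matrix.smul_apply, smul_eq_mul, h1, Finset.mul_sum]
  rw [Finset.sum_comm]
  simp only [← mul_assoc, ← Finset.sum_mul, unit_sign_sum, ite_mul, zero_mul]
  rw [← Finset.sum_filter]
  symm
  refine Finset.sum_bij (fun σ _ => (σ : Fin n → Fin n)) ?_ ?_ ?_ ?_
  · intro σ _
    exact Finset.mem_filter.mpr ⟨Finset.mem_univ _, σ.bijective⟩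
  · intro σ _ τ _ h
    exact DFunLike.coe_injective h
  · intro c hc
    exact ⟨Equiv.ofBijective c (Finset.mem_filter.mp hc).2, Finset.mem_univ _, rfl⟩
  · intro σ _
    rfl

theorem comm_sym {n d : ℕ} (Y : Matrix (Fin n → Fin d) (Fin n → Fin d) ℂ)
    (h : ∀ A : Matrix (Fin d) (Fin d) ℂ, kroneckerPower n A * Y = Y * kroneckerPower n A)
    (B : Matrix (Fin n → Fin d) (Fin n → Fin d) ℂ)
    (hB : ∀ (σ : Equiv.Perm (Fin n)) f g, B (f ∘ σ) (g ∘ σ) = B f g) :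
    B * Y = Y * B := by
  have key : ∑ p : Fin n → Fin d, ∑ q : Fin n → Fin d, B p q •
      (∑ e : Fin n → ℤˣ, (∏ k, ((e k : ℤ) : ℂ)) •
      kroneckerPower n (∑ j, ((e j : ℤ) : ℂ) • Matrix.single (p j) (q j) (1 : ℂ))) =
      ((2 : ℂ) ^ n * (n.factorial : ℂ)) • B := by
    ext f g
    simp only [Matrix.sum_apply _ _ Finset.univ (fun p : Fin n → Fin d => ∑ q : Fin n → Fin d, _)]
    simp only [Matrix.sum_apply _ _ Finset.univ (fun q : Fin n → Fin d => B _ _ • _)]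
    simp only [Matrix.smul_apply _ (∑ e : Fin n → ℤˣ, _), polarize]
    have h1 : ∀ (p q : Fin n → Fin d) (σ : Equiv.Perm (Fin n)),
        ∏ k, Matrix.single (p (σ k)) (q (σ k)) (1 : ℂ) (f k) (g k) =
        if p = f ∘ σ.symm ∧ q = g ∘ σ.symm then 1 else 0 := by
      intro p q σ
      simp only [Matrix.single_apply]
      rw [Finset.prod_ite_zero]
      simp only [Finset.prod_const_one]
      congr 1
      simp only [Finset.mem_univ, true_imp_iff, forall_and, eq_iff_iff,
        Equiv.eq_comp_symm]
      simp only [funext_iff, Function.comp]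
    simp only [h1, smul_eq_mul, Matrix.smul_apply]
    have h2 : ∀ σ : Equiv.Perm (Fin n), ∑ p : Fin n → Fin d, ∑ q : Fin n → Fin d,
        B p q * (if p = f ∘ σ.symm ∧ q = g ∘ σ.symm then 1 else 0) = B f g := by
      intro σ
      simp [ite_and, hB]
    have h3 : ∀ p q : Fin n → Fin d, B p q * (2 ^ n * ∑ σ : Equiv.Perm (Fin n),
        (if p = f ∘ σ.symm ∧ q = g ∘ σ.symm then (1 : ℂ) else 0)) = ∑ σ : Equiv.Perm (Fin n),
        2 ^ n * (B p q * (if p = f ∘ σ.symm ∧ q = g ∘ σ.symm then 1 else 0)) := by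
      intro p q
      rw [Finset.mul_sum, Finset.mul_sum]
      exact Finset.sum_congr rfl fun _ _ => by ring
    simp only [h3]
    rw [Finset.sum_congr rfl fun p _ => Finset.sum_comm, Finset.sum_comm]
    simp only [← Finset.mul_sum, h2]
    simp [Fintype.card_perm, mul_assoc]
  have hc : (((2 : ℂ) ^ n * (n.factorial : ℂ)) • B) * Y =
      Y * (((2 : ℂ) ^ n * (n.factorial : ℂ)) • B) := by
    rw [← key]
    simp only [Finset.sum_mul, Finset.mul_sum, Matrix.smul_mul, Matrix.mul_smul, h]
  rw [Matrix.smul_mul, Matrix.mul_smul] at hc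
  refine smul_right_injective _ ?_ hc
  exact mul_ne_zero (pow_ne_zero _ two_ne_zero) (Nat.cast_ne_zero.mpr n.factorial_ne_zero)

theorem perm_mul_apply {n d : ℕ} (σ : Equiv.Perm (Fin n))
    (Z : Matrix (Fin n → Fin d) (Fin n → Fin d) ℂ) (f g : Fin n → Fin d) :
    (permMatrix n d σ * Z) f g = Z (f ∘ σ) g := by
  rw [Matrix.mul_apply, Finset.sum_eq_single (f ∘ σ)]
  · simp [permMatrix, Function.comp_assoc]
  · intro b _ hb
    have : f ≠ b ∘ ⇑σ⁻¹ := by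
      rintro rfl
      exact hb (funext fun x => by simp)
    rw [permMatrix, if_neg this, zero_mul]
  · simp

theorem perm_mul_perm {n d : ℕ} (σ τ : Equiv.Perm (Fin n)) :
    permMatrix n d σ * permMatrix n d τ = permMatrix n d (σ * τ) := by
  ext f g
  rw [perm_mul_apply]
  simp only [permMatrix]
  congr 1
  rw [eq_iff_iff, _root_.mul_inv_rev]
  constructor
  · intro h
    funext x
    have := congrFun h (σ⁻¹ x)
    simpa using this
  · intro h
    funext x
    have := congrFun h (σ x)
    simpa using this

theorem perm_one {n d : ℕ} : permMatrix n d 1 = 1 := by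
  ext f g
  simp [permMatrix, Matrix.one_apply]

theorem double_comm {n d : ℕ} (Y : Matrix (Fin n → Fin d) (Fin n → Fin d) ℂ)
    (h : ∀ B : Matrix (Fin n → Fin d) (Fin n → Fin d) ℂ,
      (∀ (σ : Equiv.Perm (Fin n)) f g, B (f ∘ σ) (g ∘ σ) = B f g) → B * Y = Y * B) :
    Y ∈ Submodule.span ℂ {M : Matrix (Fin n → Fin d) (Fin n → Fin d) ℂ |
        ∃ σ : Equiv.Perm (Fin n), M = permMatrix n d σ} := by
  set S := Submodule.span ℂ {M : Matrix (Fin n → Fin d) (Fin n → Fin d) ℂ |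
        ∃ σ : Equiv.Perm (Fin n), M = permMatrix n d σ} with hS
  obtain ⟨π, hπ⟩ := S.subtype.exists_leftInverse_of_injective S.ker_subtype
  have hπS : ∀ Z (hZ : Z ∈ S), (π Z : Matrix (Fin n → Fin d) (Fin n → Fin d) ℂ) = Z := by
    intro Z hZ
    exact congrArg Subtype.val (LinearMap.congr_fun hπ ⟨Z, hZ⟩)
  have hmulS : ∀ (σ : Equiv.Perm (Fin n)) Z, Z ∈ S → permMatrix n d σ * Z ∈ S := by
    intro σ Z hZ
    induction hZ using Submodule.span_induction with
    | mem x hx =>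
      obtain ⟨τ, rfl⟩ := hx
      rw [perm_mul_perm]
      exact Submodule.subset_span ⟨_, rfl⟩
    | zero => simp
    | add x y _ _ hx hy => rw [Matrix.mul_add]; exact S.add_mem hx hy
    | smul a x _ hx => rw [Matrix.mul_smul]; exact S.smul_mem _ hx
  -- the averaged projection
  let Q : Matrix (Fin n → Fin d) (Fin n → Fin d) ℂ →ₗ[ℂ]
      Matrix (Fin n → Fin d) (Fin n → Fin d) ℂ :=
    ∑ σ : Equiv.Perm (Fin n), (LinearMap.mulLeft ℂ (permMatrix n d σ⁻¹)) ∘ₗ S.subtype ∘ₗ π ∘ₗ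
      (LinearMap.mulLeft ℂ (permMatrix n d σ))
  have hQ : ∀ Z, Q Z = ∑ σ : Equiv.Perm (Fin n), permMatrix n d σ⁻¹ *
      (π (permMatrix n d σ * Z) : Matrix (Fin n → Fin d) (Fin n → Fin d) ℂ) := by
    intro Z
    simp [Q]
  have hQS : ∀ Z, Q Z ∈ S := by
    intro Z
    rw [hQ]
    exact S.sum_mem fun σ _ => hmulS _ _ (π _).2
  have h1S : (1 : Matrix (Fin n → Fin d) (Fin n → Fin d) ℂ) ∈ S :=
    Submodule.subset_span ⟨1, perm_one.symm⟩
  have hQ1 : Q 1 = (n.factorial : ℂ) • (1 : Matrix (Fin n → Fin d) (Fin n → Fin d) ℂ) := by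
    rw [hQ]
    have : ∀ σ : Equiv.Perm (Fin n), permMatrix n d σ⁻¹ *
      (π (permMatrix n d σ * 1) : Matrix (Fin n → Fin d) (Fin n → Fin d) ℂ) = 1 := by
      intro σ
      rw [hπS _ (hmulS σ _ h1S), Matrix.mul_one, perm_mul_perm, inv_mul_cancel, perm_one]
    simp only [this, Finset.sum_const, Finset.card_univ, Fintype.card_perm, Fintype.card_fin]
    rw [Nat.cast_smul_eq_nsmul]
  have hQP : ∀ (τ : Equiv.Perm (Fin n)) Z, Q (permMatrix n d τ * Z) = permMatrix n d τ * Q Z := by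
    intro τ Z
    rw [hQ, hQ, Finset.mul_sum]
    refine Fintype.sum_equiv (Equiv.mulRight τ) _ _ fun σ => ?_
    simp only [Equiv.coe_mulRight, _root_.mul_inv_rev]
    rw [← Matrix.mul_assoc, ← Matrix.mul_assoc, perm_mul_perm, perm_mul_perm,
      mul_inv_cancel_left]
  -- column blocks of `Q`
  let C : (Fin n → Fin d) → (Fin n → Fin d) → Matrix (Fin n → Fin d) (Fin n → Fin d) ℂ :=
    fun j l i k => Q (Matrix.single k l 1) i j
  have hC : ∀ Z i j, Q Z i j = ∑ l, ∑ k, C j l i k * Z k l := by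
    intro Z i j
    conv_lhs => rw [Matrix.matrix_eq_sum_single Z]
    rw [Finset.sum_comm]
    simp only [map_sum, Matrix.sum_apply]
    refine Finset.sum_congr rfl fun l _ => Finset.sum_congr rfl fun k _ => ?_
    have : Matrix.single k l (Z k l) = Z k l • Matrix.single k l (1 : ℂ) := by
      simp [Matrix.smul_single]
    rw [this, map_smul, Matrix.smul_apply, smul_eq_mul, mul_comm]
  have hCsym : ∀ j l (σ : Equiv.Perm (Fin n)) f g, C j l (f ∘ σ) (g ∘ σ) = C j l f g := by
    intro j l σ f g
    have h1 : permMatrix n d σ * Matrix.single (g ∘ σ) l (1 : ℂ) = Matrix.single g l 1 := by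
      ext a b
      rw [perm_mul_apply, Matrix.single_apply, Matrix.single_apply]
      congr 1
      rw [eq_iff_iff, (σ.surjective.injective_comp_right).eq_iff]
    simp only [C]
    rw [← h1, hQP, perm_mul_apply]
  have hQY : Q Y = Y * Q 1 := by
    ext i j
    have hc : ∀ l, (C j l * Y) i l = (Y * C j l) i l := fun l => by rw [h _ (hCsym j l)]
    rw [hC, Matrix.mul_apply]
    simp only [Matrix.mul_apply] at hc
    simp only [hc, hC 1, Finset.mul_sum]
    rw [Finset.sum_comm]
    refine Finset.sum_congr rfl fun l _ => Finset.sum_congr rfl fun k _ => ?_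
    simp [Matrix.one_apply]
  have hfac : (n.factorial : ℂ) ≠ 0 := Nat.cast_ne_zero.mpr n.factorial_ne_zero
  have hmem := hQS Y
  rw [hQY, hQ1, Matrix.mul_smul, Matrix.mul_one] at hmem
  exact (S.smul_mem_iff hfac).mp hmem

/-- The Haar twirl `∫ U^{⊗n} X (U^{⊗n})ᴴ dμ(U)` of any matrix lies in the span of the
permutation matrices. -/
theorem stmt2 (n d : ℕ) (hn : 0 < n) (hd : 0 < d)
    [MeasurableSpace (Matrix.unitaryGroup (Fin d) ℂ)]
    [BorelSpace (Matrix.unitaryGroup (Fin d) ℂ)]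
    (μ : Measure (Matrix.unitaryGroup (Fin d) ℂ))
    [μ.IsHaarMeasure] [IsProbabilityMeasure μ]
    (X : Matrix (Fin n → Fin d) (Fin n → Fin d) ℂ) :
    (fun f g => ∫ U : Matrix.unitaryGroup (Fin d) ℂ,
        (kroneckerPower n (U : Matrix (Fin d) (Fin d) ℂ) * X *
          (kroneckerPower n (U : Matrix (Fin d) (Fin d) ℂ))ᴴ) f g ∂μ) ∈
      Submodule.span ℂ {M : Matrix (Fin n → Fin d) (Fin n → Fin d) ℂ |
        ∃ σ : Equiv.Perm (Fin n), M = permMatrix n d σ} := by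
  exact double_comm _ fun B hB => comm_sym _ (fun A => comm_all _
    (fun V => twirl_comm n d μ X _ rfl V) A) B hB
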